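/- (Corollary, case h = 3/q with q ≡ 1 mod 3) As q → ∞ through integers q = 3ν+1 (ν = 2, 3, …), with h = 3/q one has A(h) = h + (16π²/243)h³ − (16π³√3/2187)h⁴ + (448π⁴/59049)h⁵ + O(h⁶). -/

import Mathlib

open Real Asymptotics Filter

/-- Membership in the Turán class `K(h)`, encoded via the nonnegative Fourier cosine
coefficient sequence `a` of a continuous 1-periodic even function
`f(x) = ∑' n, a n * cos (2πnx)`: all `a n ≥ 0`, `∑ a n = 1` (so `f 0 = 1`), and
`f x = 0` for `h ≤ |x| ≤ 1/2`. -/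
def memK (h : ℝ) (a : ℕ → ℝ) : Prop :=
  (∀ n, 0 ≤ a n) ∧ Summable a ∧ (∑' n, a n) = 1 ∧
    ∀ x : ℝ, h ≤ |x| → |x| ≤ 1 / 2 → (∑' n : ℕ, a n * Real.cos (2 * π * n * x)) = 0

/-- The Turán constant `A(h) = sup_{f ∈ K(h)} a₀`. -/
noncomputable def turanA (h : ℝ) : ℝ :=
  sSup {y : ℝ | ∃ a : ℕ → ℝ, memK h a ∧ y = a 0}


/-! ### The discrete upper bound -/

lemma sum_range_cos_nonneg (q : ℕ) (m : ℤ) :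
    0 ≤ ∑ j ∈ Finset.range q, Real.cos (2 * π * m * j / q) := by
  rcases Nat.eq_zero_or_pos q with rfl | hq
  · simp
  have hq' : (q : ℂ) ≠ 0 := by exact_mod_cast hq.ne'
  set z : ℂ := Complex.exp (2 * π * m / q * Complex.I) with hz
  have hre : ∀ j : ℕ, Real.cos (2 * π * m * j / q) = (z ^ j).re := by
    intro j
    rw [hz, ← Complex.exp_nat_mul,
      show (j : ℂ) * (2 * π * m / q * Complex.I)
        = ((2 * π * m * j / q : ℝ) : ℂ) * Complex.I by push_cast; ring,
      Complex.exp_ofReal_mul_I_re]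
  simp_rw [hre]
  rw [← Complex.re_sum]
  by_cases h1 : z = 1
  · simp [h1]
  · have hzq : z ^ q = 1 := by
      rw [hz, ← Complex.exp_nat_mul, Complex.exp_eq_one_iff]
      exact ⟨m, by field_simp⟩
    rw [geom_sum_eq h1, hzq]
    simp

/-- The cosine series with coefficients `a`. -/
noncomputable def cosSeries (a : ℕ → ℝ) (x : ℝ) : ℝ := ∑' n : ℕ, a n * Real.cos (2 * π * n * x)

lemma summable_mul_cos {a : ℕ → ℝ} (ha : ∀ n, 0 ≤ a n) (hs : Summable a) (t : ℕ → ℝ) :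
    Summable fun n => a n * Real.cos (t n) := by
  refine Summable.of_norm_bounded hs fun n => ?_
  rw [norm_mul, Real.norm_of_nonneg (ha n)]
  exact mul_le_of_le_one_right (ha n) (Real.abs_cos_le_one _)

lemma cosSeries_sub_one (a : ℕ → ℝ) (x : ℝ) : cosSeries a (x - 1) = cosSeries a x := by
  unfold cosSeries
  congr 1; ext n
  rw [← Real.cos_sub_nat_mul_two_pi (2 * π * n * x) n]
  ring_nf

lemma cosSeries_neg (a : ℕ → ℝ) (x : ℝ) : cosSeries a (-x) = cosSeries a x := by
  unfold cosSeries
  congr 1; ext n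
  rw [← Real.cos_neg]
  ring_nf

lemma hasSum_sum_cosSeries {a : ℕ → ℝ} (ha : ∀ n, 0 ≤ a n) (hs : Summable a) (q k : ℕ) :
    HasSum (fun n => a n * ∑ j ∈ Finset.range q,
        Real.cos (2 * π * n * (j / q)) * Real.cos (2 * π * k * (j / q)))
      (∑ j ∈ Finset.range q, cosSeries a (j / q) * Real.cos (2 * π * k * (j / q))) := by
  have := hasSum_sum (s := Finset.range q) fun (j : ℕ) _ =>
    (summable_mul_cos ha hs fun n => 2 * π * n * (j / q)).hasSum.mul_right
      (Real.cos (2 * π * k * (j / q)))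
  convert! this using 2 with n
  simp only [Finset.mul_sum, mul_assoc]

lemma sum_range_cos_mul_cos_nonneg (q n k : ℕ) :
    0 ≤ ∑ j ∈ Finset.range q,
        Real.cos (2 * π * n * (j / q)) * Real.cos (2 * π * k * (j / q)) := by
  have h1 := sum_range_cos_nonneg q (n - k)
  have h2 := sum_range_cos_nonneg q (n + k)
  have : ∑ j ∈ Finset.range q,
        Real.cos (2 * π * n * (j / q)) * Real.cos (2 * π * k * (j / q))
      = ((∑ j ∈ Finset.range q, Real.cos (2 * π * ((n - k : ℤ) : ℝ) * j / q))
        + ∑ j ∈ Finset.range q, Real.cos (2 * π * ((n + k : ℤ) : ℝ) * j / q)) / 2 := by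
    rw [← Finset.sum_add_distrib, Finset.sum_div]
    refine Finset.sum_congr rfl fun j _ => ?_
    rw [show 2 * π * ((n - k : ℤ) : ℝ) * j / q = 2 * π * n * (j / q) - 2 * π * k * (j / q) by
        push_cast; ring,
      show 2 * π * ((n + k : ℤ) : ℝ) * j / q = 2 * π * n * (j / q) + 2 * π * k * (j / q) by
        push_cast; ring, Real.cos_sub, Real.cos_add]
    ring
  rw [this]
  positivity

lemma sum_cosSeries_nonneg {a : ℕ → ℝ} (ha : ∀ n, 0 ≤ a n) (hs : Summable a) (q k : ℕ) :
    0 ≤ ∑ j ∈ Finset.range q, cosSeries a (j / q) * Real.cos (2 * π * k * (j / q)) :=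
  (hasSum_sum_cosSeries ha hs q k).nonneg fun n =>
    mul_nonneg (ha n) (sum_range_cos_mul_cos_nonneg q n k)

lemma mul_coeff_zero_le_sum_cosSeries {a : ℕ → ℝ} (ha : ∀ n, 0 ≤ a n) (hs : Summable a) (q : ℕ) :
    q * a 0 ≤ ∑ j ∈ Finset.range q, cosSeries a (j / q) := by
  have h := le_hasSum (hasSum_sum_cosSeries ha hs q 0) 0 fun n _ =>
    mul_nonneg (ha n) (sum_range_cos_mul_cos_nonneg q n 0)
  simpa [mul_comm] using h

/-- A series in `K(3/q)` is determined on the grid `ℤ/q` by its values at `1/q` and `2/q`. -/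
lemma sum_cosSeries_eq {q : ℕ} (hq : 5 ≤ q) {a : ℕ → ℝ} (ha : memK (3 / q) a) (k : ℕ) :
    ∑ j ∈ Finset.range q, cosSeries a (j / q) * Real.cos (2 * π * k * (j / q))
      = 1 + 2 * cosSeries a (1 / q) * Real.cos (2 * π * k / q)
        + 2 * cosSeries a (2 / q) * Real.cos (2 * (2 * π * k / q)) := by
  obtain ⟨r, rfl⟩ := Nat.exists_eq_add_of_le' hq
  obtain ⟨-, -, h1, h0⟩ := ha
  have hq0 : ((r + 5 : ℕ) : ℝ) ≠ 0 := by positivity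
  have hqpos : (0 : ℝ) < ((r + 5 : ℕ) : ℝ) := by positivity
  have hc0 : cosSeries a 0 = 1 := by simpa [cosSeries] using h1
  have hcos : ∀ i : ℕ, i ≤ r + 5 →
      Real.cos (2 * π * k * (((r + 5 - i : ℕ) : ℝ) / (r + 5 : ℕ)))
        = Real.cos (2 * π * k * (i / (r + 5 : ℕ))) := by
    intro i hi
    rw [← Real.cos_nat_mul_two_pi_sub (2 * π * k * (i / (r + 5 : ℕ))) k, Nat.cast_sub hi]
    congr 1
    field_simp
  have hser : ∀ i : ℕ, i ≤ r + 5 →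
      cosSeries a (((r + 5 - i : ℕ) : ℝ) / (r + 5 : ℕ)) = cosSeries a (i / (r + 5 : ℕ)) := by
    intro i hi
    rw [← cosSeries_sub_one, ← cosSeries_neg, Nat.cast_sub hi]
    congr 1
    field_simp
    ring
  have hhalf : ∀ i : ℕ, 3 ≤ i → 2 * i ≤ r + 5 → cosSeries a (i / (r + 5 : ℕ)) = 0 := by
    intro i hi hi'
    have hi3 : (3 : ℝ) ≤ i := by exact_mod_cast hi
    have hi2 : 2 * (i : ℝ) ≤ (r + 5 : ℕ) := by exact_mod_cast hi'
    apply h0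
    · rw [abs_of_nonneg (by positivity)]
      gcongr
    · rw [abs_of_nonneg (by positivity), div_le_div_iff₀ hqpos two_pos]
      linarith
  have hmid : ∀ i ∈ Finset.range r, cosSeries a (((i + 3 : ℕ) : ℝ) / (r + 5 : ℕ))
      * Real.cos (2 * π * k * (((i + 3 : ℕ) : ℝ) / (r + 5 : ℕ))) = 0 := by
    intro i hi
    rw [Finset.mem_range] at hi
    rcases le_total (2 * (i + 3)) (r + 5) with h | h
    · rw [hhalf _ (by omega) h, zero_mul]
    · have := hser (r + 5 - (i + 3)) (by omega)
      rw [show r + 5 - (r + 5 - (i + 3)) = i + 3 by omega] at this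
      rw [this, hhalf _ (by omega) (by omega), zero_mul]
  have e1 := hser 1 (by omega)
  have e2 := hser 2 (by omega)
  have f1 := hcos 1 (by omega)
  have f2 := hcos 2 (by omega)
  rw [show r + 5 - 1 = r + 4 by omega] at e1 f1
  rw [show r + 5 - 2 = r + 3 by omega] at e2 f2
  rw [Finset.sum_range_succ, Finset.sum_range_succ, e1, e2, f1, f2, Finset.sum_range_succ',
    Finset.sum_range_succ', Finset.sum_range_succ',
    Finset.sum_eq_zero (by simpa only [add_assoc, Nat.reduceAdd] using hmid)]
  simp only [Nat.cast_zero, zero_div, hc0, mul_zero, Real.cos_zero, zero_add, Nat.cast_one,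
    Nat.cast_ofNat, Nat.reduceAdd]
  rw [show 2 * π * k * (1 / ((r + 5 : ℕ) : ℝ)) = 2 * π * k / ((r + 5 : ℕ) : ℝ) by ring,
    show 2 * π * k * (2 / ((r + 5 : ℕ) : ℝ)) = 2 * (2 * π * k / ((r + 5 : ℕ) : ℝ)) by ring]
  ring

/-- Linear programming duality for the discrete problem with two active constraints. -/
lemma le_of_two_constraints {α β u v : ℝ} (hα : -(1 / 2) < α) (hα1 : α ≤ 1)
    (hβ : β < -(1 / 2)) (hαβ : 0 < 2 * α * β + 1)
    (h1 : 0 ≤ 1 + 2 * u * α + 2 * v * (2 * α ^ 2 - 1))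
    (h2 : 0 ≤ 1 + 2 * u * β + 2 * v * (2 * β ^ 2 - 1)) :
    1 + 2 * u + 2 * v ≤ 2 * ((1 - α) * (1 - β)) / (2 * α * β + 1) := by
  rw [le_div_iff₀ hαβ]
  have e : (α - β) * (2 * ((1 - α) * (1 - β)) - (1 + 2 * u + 2 * v) * (2 * α * β + 1))
      = (1 - β) * (-1 - 2 * β) * (1 + 2 * u * α + 2 * v * (2 * α ^ 2 - 1))
        + (1 - α) * (1 + 2 * α) * (1 + 2 * u * β + 2 * v * (2 * β ^ 2 - 1)) := by ring
  have hpos : 0 ≤ (α - β) * (2 * ((1 - α) * (1 - β)) - (1 + 2 * u + 2 * v) * (2 * α * β + 1)) := by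
    rw [e]
    have := mul_nonneg (mul_nonneg (by linarith : 0 ≤ 1 - β) (by linarith : 0 ≤ -1 - 2 * β)) h1
    have := mul_nonneg (mul_nonneg (by linarith : 0 ≤ 1 - α) (by linarith : 0 ≤ 1 + 2 * α)) h2
    linarith
  have := nonneg_of_mul_nonneg_right hpos (by linarith)
  linarith

/-! ### The extremal function -/

lemma hasSum_cos_div_sq {x : ℝ} (h0 : 0 ≤ x) (h1 : x ≤ 1) :
    HasSum (fun n : ℕ => 1 / (n : ℝ) ^ 2 * Real.cos (2 * π * n * x))
      (π ^ 2 * (x ^ 2 - x + 1 / 6)) := by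
  have h := hasSum_one_div_nat_pow_mul_cos one_ne_zero ⟨h0, h1⟩
  have e : (Polynomial.map (algebraMap ℚ ℝ) (Polynomial.bernoulli (2 * 1))).eval x
      = x ^ 2 - x + 1 / 6 := by
    have := bernoulliFun_two x
    rw [bernoulliFun] at this
    rw [mul_one, this]; norm_num
  rw [e] at h
  convert! h using 1
  simp only [mul_one, Nat.factorial_two, Nat.cast_ofNat]
  ring

/-- Fourier cosine coefficients of the piecewise linear even function with nodes at `j / q`
and values `1`, `u`, `v` at `0`, `1 / q`, `2 / q`, vanishing at the other nodes. -/
noncomputable def interpCoeff (q : ℕ) (u v : ℝ) (n : ℕ) : ℝ :=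
  if n = 0 then (1 + 2 * u + 2 * v) / q else
    q / π ^ 2 * (1 / (n : ℝ) ^ 2) * ((1 - Real.cos (2 * π * n / q)) *
      (1 + 2 * u * Real.cos (2 * π * n / q) + 2 * v * Real.cos (2 * (2 * π * n / q))))

lemma hasSum_interpCoeff_mul_cos {q : ℕ} (hq : 0 < q) (u v x : ℝ) (B : ℝ → ℝ)
    (hB : ∀ i : ℝ, i = 0 ∨ i = 1 ∨ i = 2 ∨ i = 3 →
      HasSum (fun n : ℕ => 1 / (n : ℝ) ^ 2 * Real.cos (2 * π * n * x) *
        Real.cos (i * (2 * π * n / q))) (π ^ 2 * B i)) :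
    HasSum (fun n => interpCoeff q u v n * Real.cos (2 * π * n * x))
      ((1 + 2 * u + 2 * v) / q + q * ((1 - u) * B 0 + (2 * u - 1 - v) * B 1
        + (2 * v - u) * B 2 - v * B 3)) := by
  have hq0 : (q : ℝ) ≠ 0 := by positivity
  have H := (((((hB 0 (by simp)).mul_left (1 - u)).add
    ((hB 1 (by simp)).mul_left (2 * u - 1 - v))).add
    ((hB 2 (by simp)).mul_left (2 * v - u))).sub ((hB 3 (by simp)).mul_left v)).mul_left (q / π ^ 2)
  have H0 := hasSum_ite_eq (0 : ℕ) ((1 + 2 * u + 2 * v) / (q : ℝ))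
  convert! H0.add H using 1
  · ext n
    by_cases hn : n = 0
    · subst hn
      simp [interpCoeff]
    · simp only [interpCoeff, if_neg hn, zero_add]
      rw [Real.cos_two_mul, Real.cos_three_mul, zero_mul, Real.cos_zero, one_mul]
      ring
  · field_simp

lemma hasSum_cos_mul_cos_div_sq {x y : ℝ} (h0 : 0 ≤ x - y) (h1 : x + y ≤ 1) (hy : 0 ≤ y) :
    HasSum (fun n : ℕ => 1 / (n : ℝ) ^ 2 * Real.cos (2 * π * n * x) * Real.cos (2 * π * n * y))
      (π ^ 2 * (x ^ 2 + y ^ 2 - x + 1 / 6)) := by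
  have H := ((hasSum_cos_div_sq h0 (by linarith)).add
    (hasSum_cos_div_sq (by linarith) h1)).div_const 2
  convert! H using 1
  · ext n
    rw [mul_sub, mul_add, Real.cos_sub, Real.cos_add]
    ring
  · ring

lemma memK_interpCoeff {q : ℕ} (hq : 6 ≤ q) {u v : ℝ} (h0 : 0 ≤ 1 + 2 * u + 2 * v)
    (h : ∀ n : ℕ, 0 ≤ 1 + 2 * u * Real.cos (2 * π * n / q)
      + 2 * v * Real.cos (2 * (2 * π * n / q))) :
    memK (3 / q) (interpCoeff q u v) := by
  have hq0 : 0 < q := by omega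
  have hqpos : (0 : ℝ) < q := by positivity
  have hq6 : (6 : ℝ) ≤ q := by exact_mod_cast hq
  have hsum1 : HasSum (interpCoeff q u v) 1 := by
    have H := hasSum_interpCoeff_mul_cos hq0 u v 0
      (fun i => (i / q) ^ 2 - i / q + 1 / 6) (by
        intro i hi
        have hi3 : 0 ≤ i ∧ i ≤ 3 := by rcases hi with rfl | rfl | rfl | rfl <;> norm_num
        have := hasSum_cos_div_sq (x := i / q) (div_nonneg hi3.1 hqpos.le)
          (by rw [div_le_one hqpos]; linarith)
        convert! this using 1
        ext n
        rw [mul_zero, Real.cos_zero, mul_one]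
        congr 2
        ring)
    convert! H using 1
    · ext n; simp
    · field_simp
      ring
  refine ⟨fun n => ?_, hsum1.summable, hsum1.tsum_eq, fun x hx hx' => ?_⟩
  · unfold interpCoeff
    split_ifs with hn
    · positivity
    · exact mul_nonneg (by positivity)
        (mul_nonneg (by linarith [Real.cos_le_one (2 * π * n / q)]) (h n))
  · have habs : ∀ n : ℕ, Real.cos (2 * π * n * x) = Real.cos (2 * π * n * |x|) := by
      intro n
      rcases abs_choice x with e | e <;> rw [e]
      rw [← Real.cos_neg]; ring_nf
    simp_rw [habs]
    have H := hasSum_interpCoeff_mul_cos hq0 u v |x|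
      (fun i => |x| ^ 2 + (i / q) ^ 2 - |x| + 1 / 6) (by
        intro i hi
        have hi3 : 0 ≤ i ∧ i ≤ 3 := by rcases hi with rfl | rfl | rfl | rfl <;> norm_num
        have hi3q : i / q ≤ 3 / q := by gcongr; exact hi3.2
        have h3q : 3 / (q : ℝ) ≤ 1 / 2 := by
          rw [div_le_div_iff₀ hqpos two_pos]; linarith
        have := hasSum_cos_mul_cos_div_sq (x := |x|) (y := i / q) (by linarith)
          (by linarith) (div_nonneg hi3.1 hqpos.le)
        convert! this using 1
        ext n
        congr 2
        ring)
    rw [H.tsum_eq]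
    field_simp
    ring

lemma cos_le_cos_of_mem_Icc {s t : ℝ} (ht : 0 ≤ t) (hts : t ≤ s) (hs : s ≤ 2 * π - t) :
    Real.cos s ≤ Real.cos t := by
  rcases le_total s π with h | h
  · exact Real.cos_le_cos_of_nonneg_of_le_pi ht h hts
  · rw [← Real.cos_two_pi_sub s]
    exact Real.cos_le_cos_of_nonneg_of_le_pi ht (by linarith) (by linarith)

/-- No point of the grid `cos (2πn/q)` lies strictly between two consecutive ones. -/
lemma cos_grid_mul_nonneg {q k : ℕ} (hk : 2 * (k + 1) ≤ q) (n : ℕ) :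
    0 ≤ (Real.cos (2 * π * n / q) - Real.cos (2 * π * k / q)) *
      (Real.cos (2 * π * n / q) - Real.cos (2 * π * (k + 1 : ℕ) / q)) := by
  have hq : 0 < q := by omega
  have hqpos : (0 : ℝ) < q := by exact_mod_cast hq
  have hmod : Real.cos (2 * π * n / q) = Real.cos (2 * π * (n % q : ℕ) / q) := by
    rw [← Real.cos_add_nat_mul_two_pi (2 * π * (n % q : ℕ) / q) (n / q)]
    congr 1
    have : (n : ℝ) = (n % q : ℕ) + q * (n / q : ℕ) := by exact_mod_cast (Nat.mod_add_div n q).symm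
    conv_lhs => rw [this]
    field_simp
  have hr : n % q < q := Nat.mod_lt _ hq
  have mono : ∀ i j : ℕ, i ≤ j → j ≤ q - i →
      Real.cos (2 * π * j / q) ≤ Real.cos (2 * π * i / q) := by
    intro i j hij hj
    refine cos_le_cos_of_mem_Icc (by positivity) (by gcongr) ?_
    have : (j : ℝ) + i ≤ q := by exact_mod_cast (by omega : j + i ≤ q)
    rw [le_sub_iff_add_le, ← add_div, div_le_iff₀ hqpos]
    nlinarith [Real.pi_pos]
  have refl' : ∀ i : ℕ, i ≤ q → Real.cos (2 * π * (q - i : ℕ) / q) = Real.cos (2 * π * i / q) := by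
    intro i hi
    rw [← Real.cos_two_pi_sub (2 * π * i / q), Nat.cast_sub hi]
    congr 1
    field_simp
  rw [hmod]
  generalize n % q = r at hr
  have hab := mono k (k + 1) (by omega) (by omega)
  rcases le_or_gt r k with h1 | h1
  · have := mono r k h1 (by omega)
    exact mul_nonneg (by linarith) (by linarith)
  rcases le_or_gt r (q - (k + 1)) with h2 | h2
  · have := mono (k + 1) r h1 h2
    exact mul_nonneg_of_nonpos_of_nonpos (by linarith) (by linarith)
  · have := mono (q - r) k (by omega) (by omega)
    rw [refl' r hr.le] at this
    exact mul_nonneg (by linarith) (by linarith)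

/-- The exact value of the Turán constant at `3 / q` when the optimal discrete kernel has its
zeros at the consecutive grid points `k / q`, `(k + 1) / q`. -/
lemma turanA_three_div {q k : ℕ} (hk : 2 * (k + 1) ≤ q) (hq : 6 ≤ q) {α β : ℝ}
    (hαe : α = Real.cos (2 * π * k / q)) (hβe : β = Real.cos (2 * π * (k + 1 : ℕ) / q))
    (hα : -(1 / 2) < α) (hβ : β < -(1 / 2)) (hαβ : 0 < 2 * α * β + 1) :
    turanA (3 / q) = 2 * ((1 - α) * (1 - β)) / (2 * α * β + 1) / q := by
  have hqpos : (0 : ℝ) < q := by positivity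
  have hα1 : α ≤ 1 := hαe ▸ Real.cos_le_one _
  refine IsGreatest.csSup_eq ⟨?_, ?_⟩
  · set v : ℝ := 1 / (2 * (2 * α * β + 1)) with hv
    set u : ℝ := -(2 * v * (α + β)) with hu
    have hv' : v * (2 * (2 * α * β + 1)) = 1 := by rw [hv]; field_simp
    have hvpos : 0 < v := by positivity
    have hkey : ∀ c : ℝ, 1 + 2 * u * c + 2 * v * (2 * c ^ 2 - 1) = 4 * v * ((c - α) * (c - β)) := by
      intro c
      rw [hu]
      linear_combination -hv'
    have hval : 1 + 2 * u + 2 * v = 2 * ((1 - α) * (1 - β)) / (2 * α * β + 1) := by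
      have := hkey 1
      rw [eq_div_iff hαβ.ne']
      linear_combination (2 * α * β + 1) * this + 2 * (1 - α) * (1 - β) * hv'
    refine ⟨interpCoeff q u v, memK_interpCoeff hq ?_ fun n => ?_, ?_⟩
    · rw [hval]
      exact div_nonneg (mul_nonneg two_pos.le (mul_nonneg (by linarith) (by linarith))) hαβ.le
    · rw [Real.cos_two_mul, hkey, hαe, hβe]
      exact mul_nonneg (by positivity) (cos_grid_mul_nonneg hk n)
    · simp [interpCoeff, hval]
  · rintro y ⟨a, ha, rfl⟩
    rw [le_div_iff₀ hqpos, mul_comm]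
    have key := sum_cosSeries_eq (by omega : 5 ≤ q) ha
    have h0 := mul_coeff_zero_le_sum_cosSeries ha.1 ha.2.1 q
    have k0 := key 0
    have k1 := key k
    have k2 := key (k + 1)
    have n1 := sum_cosSeries_nonneg ha.1 ha.2.1 q k
    have n2 := sum_cosSeries_nonneg ha.1 ha.2.1 q (k + 1)
    rw [k1, Real.cos_two_mul, ← hαe] at n1
    rw [k2, Real.cos_two_mul, ← hβe] at n2
    simp only [Nat.cast_zero, mul_zero, zero_mul, Real.cos_zero, mul_one, zero_div] at k0
    rw [k0] at h0
    exact h0.trans (le_of_two_constraints hα hα1 hβ hαβ n1 n2)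

/-! ### The expansion -/

lemma exp_mul_I_sub_isBigO :
    (fun x : ℝ => Complex.exp (x * Complex.I)
        - ∑ i ∈ Finset.range 5, ((x : ℂ) * Complex.I) ^ i / (i.factorial : ℂ))
      =O[nhds 0] fun x : ℝ => x ^ 5 := by
  have ht : Tendsto (fun x : ℝ => (x : ℂ) * Complex.I) (nhds 0) (nhds 0) :=
    Continuous.tendsto' (by fun_prop) _ _ (by simp)
  refine ((Complex.exp_sub_sum_range_isBigO_pow 5).comp_tendsto ht).trans ?_
  exact isBigO_of_le _ fun x => by simp

lemma cos_sub_isBigO :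
    (fun x : ℝ => Real.cos x - (1 - x ^ 2 / 2 + x ^ 4 / 24)) =O[nhds 0] fun x => x ^ 5 := by
  refine (isBigO_of_le _ fun x => ?_).trans exp_mul_I_sub_isBigO
  refine le_trans (le_of_eq ?_) (Complex.abs_re_le_norm _)
  rw [Real.norm_eq_abs, Complex.sub_re, Complex.exp_ofReal_mul_I_re]
  congr 2
  simp [Finset.sum_range_succ, Nat.factorial, mul_pow, Complex.I_pow_three, Complex.I_pow_four]
  norm_cast
  simp
  ring

lemma sin_sub_isBigO :
    (fun x : ℝ => Real.sin x - (x - x ^ 3 / 6)) =O[nhds 0] fun x => x ^ 5 := by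
  refine (isBigO_of_le _ fun x => ?_).trans exp_mul_I_sub_isBigO
  refine le_trans (le_of_eq ?_) (Complex.abs_im_le_norm _)
  rw [Real.norm_eq_abs, Complex.sub_im, Complex.exp_ofReal_mul_I_im]
  congr 2
  simp [Finset.sum_range_succ, Nat.factorial, mul_pow, Complex.I_pow_three, Complex.I_pow_four]
  norm_cast
  simp
  ring

/-- The value of the discrete problem as a function of `δ = 2π / (3q)`. -/
noncomputable def discreteValue (δ : ℝ) : ℝ :=
  2 * ((1 - -Real.cos (π / 3 + δ)) * (1 - -Real.cos (π / 3 - 2 * δ))) /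
    (2 * -Real.cos (π / 3 + δ) * -Real.cos (π / 3 - 2 * δ) + 1)

lemma cos_comp_mul_sub_isBigO (k : ℝ) :
    (fun x : ℝ => Real.cos (k * x) - (1 - (k * x) ^ 2 / 2 + (k * x) ^ 4 / 24))
      =O[nhds 0] fun x => x ^ 5 := by
  have ht : Tendsto (fun x : ℝ => k * x) (nhds 0) (nhds 0) :=
    Continuous.tendsto' (by fun_prop) _ _ (by simp)
  refine (cos_sub_isBigO.comp_tendsto ht).trans ?_
  simp only [Function.comp_def, mul_pow]
  exact isBigO_const_mul_self _ _ _

lemma sin_comp_mul_sub_isBigO (k : ℝ) :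
    (fun x : ℝ => Real.sin (k * x) - (k * x - (k * x) ^ 3 / 6)) =O[nhds 0] fun x => x ^ 5 := by
  have ht : Tendsto (fun x : ℝ => k * x) (nhds 0) (nhds 0) :=
    Continuous.tendsto' (by fun_prop) _ _ (by simp)
  refine (sin_sub_isBigO.comp_tendsto ht).trans ?_
  simp only [Function.comp_def, mul_pow]
  exact isBigO_const_mul_self _ _ _

lemma pow_five_mul_isBigO {f : ℝ → ℝ} (hf : Continuous f) :
    (fun x => f x * x ^ 5) =O[nhds 0] fun x : ℝ => x ^ 5 := by
  simpa using ((hf.tendsto 0).isBigO_one ℝ).mul (isBigO_refl (fun x : ℝ => x ^ 5) _)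

lemma discreteValue_sub_isBigO :
    (fun δ => discreteValue δ
        - 3 * (1 + 4 / 3 * δ ^ 2 - 2 * √3 / 3 * δ ^ 3 + 28 / 9 * δ ^ 4))
      =O[nhds 0] fun δ => δ ^ 5 := by
  set D : ℝ → ℝ := fun δ => 2 * -Real.cos (π / 3 + δ) * -Real.cos (π / 3 - 2 * δ) + 1 with hD
  set P : ℝ → ℝ := fun δ => 3 * (1 + 4 / 3 * δ ^ 2 - 2 * √3 / 3 * δ ^ 3 + 28 / 9 * δ ^ 4) with hP
  set N : ℝ → ℝ := fun δ => 2 * ((1 - -Real.cos (π / 3 + δ)) * (1 - -Real.cos (π / 3 - 2 * δ)))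
    with hN
  have hs : √3 ^ 2 = 3 := Real.sq_sqrt (by norm_num)
  have hDc : Continuous D := by fun_prop
  have hD0 : D 0 ≠ 0 := by simp [hD, Real.cos_pi_div_three]; norm_num
  have hDev : ∀ᶠ δ in nhds 0, D δ ≠ 0 := hDc.continuousAt.eventually_ne hD0
  have hDinv : (fun δ => (D δ)⁻¹) =O[nhds 0] fun _ => (1 : ℝ) :=
    (hDc.continuousAt.inv₀ hD0).isBigO_one ℝ
  have hcos1 : ∀ δ, Real.cos (π / 3 + δ) = Real.cos (1 * δ) / 2 - √3 / 2 * Real.sin (1 * δ) := by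
    intro δ
    rw [Real.cos_add, Real.cos_pi_div_three, Real.sin_pi_div_three, one_mul]
    ring
  have hcos2 : ∀ δ, Real.cos (π / 3 - 2 * δ)
      = Real.cos (2 * δ) / 2 + √3 / 2 * Real.sin (2 * δ) := by
    intro δ
    rw [Real.cos_sub, Real.cos_pi_div_three, Real.sin_pi_div_three]
    ring
  have hDe : ∀ δ, D δ = Real.cos (3 * δ) - Real.cos (1 * δ) / 2 + √3 / 2 * Real.sin (1 * δ)
      + 1 := by
    intro δ
    have h1 : Real.cos (π / 3 + δ - (π / 3 - 2 * δ)) = Real.cos (3 * δ) := by ring_nf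
    have h2 : Real.cos (π / 3 + δ + (π / 3 - 2 * δ))
        = -(Real.cos (1 * δ) / 2) + √3 / 2 * Real.sin (1 * δ) := by
      rw [show π / 3 + δ + (π / 3 - 2 * δ) = π - (π / 3 + δ) by ring, Real.cos_pi_sub, hcos1]
      ring
    rw [Real.cos_sub] at h1
    rw [Real.cos_add] at h2
    simp only [hD]
    linear_combination h1 + h2
  have hNe : ∀ δ, N δ = D δ + 1 + (Real.cos (1 * δ) - √3 * Real.sin (1 * δ))
      + (Real.cos (2 * δ) + √3 * Real.sin (2 * δ)) := by
    intro δ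
    simp only [hN, hD]
    rw [hcos1, hcos2]
    ring
  have c1 := cos_comp_mul_sub_isBigO 1
  have c2 := cos_comp_mul_sub_isBigO 2
  have c3 := cos_comp_mul_sub_isBigO 3
  have s1 := sin_comp_mul_sub_isBigO 1
  have s2 := sin_comp_mul_sub_isBigO 2
  have dD : (fun δ => D δ - (3 / 2 + √3 / 2 * δ - 17 / 4 * δ ^ 2 - √3 / 12 * δ ^ 3
      + 161 / 48 * δ ^ 4)) =O[nhds 0] fun δ => δ ^ 5 := by
    refine ((c3.sub (c1.const_mul_left (1 / 2))).add (s1.const_mul_left (√3 / 2))).congr_left ?_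
    intro δ
    rw [hDe]
    ring
  have dN : (fun δ => N δ - (9 / 2 + 3 * √3 / 2 * δ - 27 / 4 * δ ^ 2 - 5 * √3 / 4 * δ ^ 3
      + 65 / 16 * δ ^ 4)) =O[nhds 0] fun δ => δ ^ 5 := by
    refine ((((dD.add c1).sub (s1.const_mul_left √3)).add c2).add
      (s2.const_mul_left √3)).congr_left ?_
    intro δ
    rw [hNe]
    ring
  have hPD : (fun δ => P δ * (D δ - (3 / 2 + √3 / 2 * δ - 17 / 4 * δ ^ 2 - √3 / 12 * δ ^ 3
      + 161 / 48 * δ ^ 4))) =O[nhds 0] fun δ => δ ^ 5 := by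
    have hPc : Continuous P := by fun_prop
    simpa using ((hPc.tendsto 0).isBigO_one ℝ).mul dD
  have hrem : (fun δ : ℝ => (-(77 / 6) * √3 + 103 / 4 * δ + 539 / 72 * √3 * δ ^ 2
      - 1127 / 36 * δ ^ 3) * δ ^ 5) =O[nhds 0] fun δ => δ ^ 5 :=
    pow_five_mul_isBigO (by fun_prop)
  have hnum : (fun δ => N δ - P δ * D δ) =O[nhds 0] fun δ => δ ^ 5 := by
    refine ((dN.sub hPD).add hrem).congr_left fun δ => ?_
    simp only [hP]
    linear_combination (-(δ ^ 4) + δ ^ 6 / 6) * hs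
  have hfin := hnum.mul hDinv
  simp only [mul_one] at hfin
  refine hfin.congr' ?_ EventuallyEq.rfl
  filter_upwards [hDev] with δ hδ
  change _ = N δ / D δ - P δ
  field_simp

lemma turanA_eq_discreteValue {ν : ℕ} (hν : 2 ≤ ν) :
    turanA (3 / (3 * (ν : ℝ) + 1))
      = discreteValue (2 * π / 9 * (3 / (3 * ν + 1))) / (3 * ν + 1) := by
  have hν' : (2 : ℝ) ≤ ν := by exact_mod_cast hν
  have hpi := Real.pi_pos
  have hq : (0 : ℝ) < 3 * ν + 1 := by positivity
  set δ : ℝ := 2 * π / 9 * (3 / (3 * ν + 1)) with hδ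
  have hδ0 : 0 < δ := by positivity
  have hδ1 : δ < π / 6 := by
    rw [hδ, div_mul_div_comm, div_lt_div_iff₀ (by positivity) (by norm_num)]
    nlinarith
  have hcast : ((3 * ν + 1 : ℕ) : ℝ) = 3 * ν + 1 := by push_cast; ring
  have hα : -Real.cos (π / 3 + δ) = Real.cos (2 * π * ν / (3 * ν + 1 : ℕ)) := by
    rw [← Real.cos_pi_sub, hcast, hδ]
    congr 1
    field_simp
    ring
  have hβ : -Real.cos (π / 3 - 2 * δ) = Real.cos (2 * π * (ν + 1 : ℕ) / (3 * ν + 1 : ℕ)) := by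
    rw [← Real.cos_pi_sub, hcast, hδ]
    congr 1
    push_cast
    field_simp
    ring
  have hA : Real.cos (π / 3 + δ) < 1 / 2 := by
    rw [← Real.cos_pi_div_three]
    exact Real.cos_lt_cos_of_nonneg_of_le_pi (by positivity) (by linarith) (by linarith)
  have hA0 : 0 ≤ Real.cos (π / 3 + δ) :=
    Real.cos_nonneg_of_mem_Icc ⟨by linarith, by linarith⟩
  have hB : 1 / 2 < Real.cos (π / 3 - 2 * δ) := by
    rw [← Real.cos_pi_div_three]
    exact Real.cos_lt_cos_of_nonneg_of_le_pi (by linarith) (by linarith) (by linarith)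
  have := turanA_three_div (q := 3 * ν + 1) (k := ν) (by omega) (by omega) hα hβ (by linarith)
    (by linarith) (by nlinarith)
  rw [hcast] at this
  exact this

/-- Corollary, case `h = 3/q`, `q = 3ν+1`: as `q → ∞`, with `h = 3/q`,
`A(h) = h + (16π²/243) h³ - (16π³√3/2187) h⁴ + (448π⁴/59049) h⁵ + O(h⁶)`. -/
theorem turanA_asymptotic_three_div_one_mod :
    (fun ν : ℕ => turanA (3 / (3 * (ν : ℝ) + 1)) -
        (3 / (3 * (ν : ℝ) + 1) + 16 * π ^ 2 / 243 * (3 / (3 * (ν : ℝ) + 1)) ^ 3 -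
          16 * π ^ 3 * Real.sqrt 3 / 2187 * (3 / (3 * (ν : ℝ) + 1)) ^ 4 +
          448 * π ^ 4 / 59049 * (3 / (3 * (ν : ℝ) + 1)) ^ 5)) =O[atTop]
      fun ν : ℕ => (3 / (3 * (ν : ℝ) + 1)) ^ 6 := by
  have h0 : Tendsto (fun ν : ℕ => 3 / (3 * (ν : ℝ) + 1)) atTop (nhds 0) :=
    tendsto_const_nhds.div_atTop <| tendsto_atTop_add_const_right _ _ <|
      tendsto_natCast_atTop_atTop.const_mul_atTop three_pos
  have hδ : Tendsto (fun ν : ℕ => 2 * π / 9 * (3 / (3 * (ν : ℝ) + 1))) atTop (nhds 0) := by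
    simpa using h0.const_mul (2 * π / 9)
  have H := ((isBigO_refl (fun ν : ℕ => 3 / (3 * (ν : ℝ) + 1)) atTop).mul
    (discreteValue_sub_isBigO.comp_tendsto hδ)).const_mul_left (1 / 3)
  refine (H.congr' ?_ EventuallyEq.rfl).trans ?_
  · filter_upwards [eventually_ge_atTop 2] with ν hν
    rw [turanA_eq_discreteValue hν]
    simp only [Function.comp_apply]
    ring
  · refine (isBigO_const_mul_self ((2 * π / 9) ^ 5) _ _).congr_left fun ν => ?_
    simp only [Function.comp_apply]
    ring
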